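/- Let M be an n×n complex Hermitian matrix with eigenvalues λ_1 ≥ λ_2 ≥ … ≥ λ_n listed in decreasing order with multiplicity, and let r ≤ n. For every complex n×r matrix X satisfying Xᴴ X = I_r, the trace of Xᴴ M X is a real number and satisfies Re(trace(Xᴴ M X)) ≤ λ_1 + λ_2 + … + λ_r. -/

import Mathlib

open Matrix BigOperators

/-- An antitone sequence of finitely many reals has a threshold separating its first `r` terms
from the others. -/
theorem Antitone.exists_threshold {n : ℕ} {a : Fin n → ℝ} (ha : Antitone a) (r : ℕ) :
    ∃ c, ∀ i : Fin n, ((i : ℕ) < r → c ≤ a i) ∧ (r ≤ i → a i ≤ c) := by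
  by_cases h : r < n
  · exact ⟨a ⟨r, h⟩, fun i => ⟨fun hi => ha (Fin.le_def.2 hi.le), fun hi => ha (Fin.le_def.2 hi)⟩⟩
  · obtain ⟨c, hc⟩ := (Set.finite_range a).bddBelow
    exact ⟨c, fun i => ⟨fun _ => hc ⟨i, rfl⟩, fun hi => absurd (hi.trans_lt i.isLt) h⟩⟩

/-- Among weights in `[0, 1]` of total mass `r`, the weighted sum of an antitone sequence is largest
when the mass sits on the first `r` terms. -/
theorem Antitone.sum_mul_le_sum_castLE {n r : ℕ} (hr : r ≤ n) {a w : Fin n → ℝ} (ha : Antitone a)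
    (hw₀ : ∀ i, 0 ≤ w i) (hw₁ : ∀ i, w i ≤ 1) (hw : ∑ i, w i = r) :
    ∑ i, a i * w i ≤ ∑ i : Fin r, a (Fin.castLE hr i) := by
  obtain ⟨k, rfl⟩ := Nat.exists_eq_add_of_le hr
  obtain ⟨c, hc⟩ := ha.exists_threshold r
  have head : ∑ i : Fin r, (a (Fin.castAdd k i) - c) * w (Fin.castAdd k i) ≤
      ∑ i : Fin r, (a (Fin.castAdd k i) - c) :=
    Finset.sum_le_sum fun i _ =>
      mul_le_of_le_one_right (sub_nonneg.2 ((hc _).1 (by simp))) (hw₁ _)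
  have tail : ∑ i : Fin k, (a (Fin.natAdd r i) - c) * w (Fin.natAdd r i) ≤ 0 :=
    Finset.sum_nonpos fun i _ =>
      mul_nonpos_of_nonpos_of_nonneg (sub_nonpos.2 ((hc _).2 (by simp))) (hw₀ _)
  have shift : ∑ i, (a i - c) * w i = ∑ i, a i * w i - c * r := by
    simp only [sub_mul, Finset.sum_sub_distrib, ← Finset.mul_sum, hw]
  rw [Fin.sum_univ_add] at shift
  have total : ∑ i : Fin r, (a (Fin.castAdd k i) - c) =
      ∑ i : Fin r, a (Fin.castLE hr i) - c * r := by
    simp [Finset.sum_sub_distrib, mul_comm, Fin.castAdd]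
  linarith

namespace Matrix

variable {m n : Type*} [Fintype n]

/-- The diagonal entries of `Y * Yᴴ` are the squared norms of the rows of `Y`. -/
theorem mul_conjTranspose_self_apply_self (Y : Matrix m n ℂ) (i : m) :
    (Y * Yᴴ) i i = ((∑ j, Complex.normSq (Y i j) : ℝ) : ℂ) := by
  simp [mul_apply, Complex.mul_conj]

/-- The rows of a semi-unitary matrix have norm at most one. -/
theorem sum_normSq_row_le_one [Fintype m] [DecidableEq n] {Y : Matrix m n ℂ} (hY : Yᴴ * Y = 1)
    (i : m) :
    ∑ j, Complex.normSq (Y i j) ≤ 1 := by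
  have idem : (Y * Yᴴ) * (Y * Yᴴ)ᴴ = Y * Yᴴ := by
    rw [conjTranspose_mul, conjTranspose_conjTranspose, Matrix.mul_assoc, ← Matrix.mul_assoc Yᴴ,
      hY, Matrix.one_mul]
  have key := mul_conjTranspose_self_apply_self (Y * Yᴴ) i
  rw [idem, mul_conjTranspose_self_apply_self, Complex.ofReal_inj] at key
  have le := Finset.single_le_sum (fun k _ => Complex.normSq_nonneg ((Y * Yᴴ) i k))
    (Finset.mem_univ i)
  rw [← key, mul_conjTranspose_self_apply_self, Complex.normSq_ofReal] at le
  by_contra! h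
  nlinarith

/-- The squared row norms of a semi-unitary matrix add up to its number of columns. -/
theorem sum_sum_normSq_eq_card [Fintype m] [DecidableEq n] {Y : Matrix m n ℂ} (hY : Yᴴ * Y = 1) :
    ∑ i, ∑ j, Complex.normSq (Y i j) = Fintype.card n := by
  have h := trace_mul_comm Y Yᴴ
  rw [hY, trace_one, trace] at h
  simp only [diag_apply, mul_conjTranspose_self_apply_self] at h
  exact_mod_cast h

/-- The trace of the compression of a real diagonal matrix is a weighted sum of its entries. -/
theorem trace_conjTranspose_mul_diagonal_mul [Fintype m] [DecidableEq m] (Y : Matrix m n ℂ)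
    (d : m → ℝ) :
    trace (Yᴴ * diagonal (fun i => (d i : ℂ)) * Y) =
      ((∑ i, d i * ∑ j, Complex.normSq (Y i j) : ℝ) : ℂ) := by
  rw [Matrix.mul_assoc, trace_mul_comm, Matrix.mul_assoc, trace]
  simp only [diag_apply, diagonal_mul, mul_conjTranspose_self_apply_self]
  push_cast
  rfl

end Matrix

/-- Let `M` be an `n×n` complex Hermitian matrix with eigenvalues
`lam 0 ≥ lam 1 ≥ … ≥ lam (n-1)` listed in decreasing order with multiplicity
(encoded by a spectral decomposition `M = U * diagonal lam * Uᴴ` with `U` unitary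
and `lam` antitone), and let `r ≤ n`.  For every complex `n×r` matrix `X` with
`Xᴴ X = I_r`, the trace of `Xᴴ M X` is real and its real part is at most
`lam 0 + ⋯ + lam (r-1)`. -/
theorem pca_trace_upper_bound {n r : ℕ} (hr : r ≤ n)
    (M : Matrix (Fin n) (Fin n) ℂ) (hM : M.IsHermitian)
    (lam : Fin n → ℝ) (hlam : Antitone lam)
    (U : Matrix (Fin n) (Fin n) ℂ) (hU : U ∈ Matrix.unitaryGroup (Fin n) ℂ)
    (hdecomp : M = U * Matrix.diagonal (fun i => (lam i : ℂ)) * Uᴴ)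
    (X : Matrix (Fin n) (Fin r) ℂ) (hX : Xᴴ * X = 1) :
    (Matrix.trace (Xᴴ * M * X)).im = 0 ∧
      (Matrix.trace (Xᴴ * M * X)).re ≤ ∑ i : Fin r, lam (Fin.castLE hr i) := by
  have hY : (Uᴴ * X)ᴴ * (Uᴴ * X) = 1 := by
    rw [conjTranspose_mul, conjTranspose_conjTranspose, Matrix.mul_assoc, ← Matrix.mul_assoc U,
      ← star_eq_conjTranspose U, Matrix.mem_unitaryGroup_iff.1 hU, Matrix.one_mul, hX]
  have htr : trace (Xᴴ * M * X) =
      ((∑ i, lam i * ∑ j, Complex.normSq ((Uᴴ * X) i j) : ℝ) : ℂ) := by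
    rw [← trace_conjTranspose_mul_diagonal_mul, hdecomp, conjTranspose_mul,
      conjTranspose_conjTranspose]
    simp only [Matrix.mul_assoc]
  rw [htr, Complex.ofReal_im, Complex.ofReal_re]
  exact ⟨rfl, hlam.sum_mul_le_sum_castLE hr
    (fun i => Finset.sum_nonneg fun j _ => Complex.normSq_nonneg _)
    (sum_normSq_row_le_one hY) (by simpa using sum_sum_normSq_eq_card hY)⟩
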